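/- arXiv:1406.6717 — 3 statements merged into one kernel-verified Lean document; each statement's English description precedes it below -/
import Mathlib

section
/- (Borel's theorem; surjectivity of the jet map, proved as part of Claim 1 in Example 4.3.) For every sequence a : ℕ → ℝ there exists a function f : ℝ → ℝ which is C^∞ such that the n-th derivative of f at 0 equals a n for every n ∈ ℕ. Equivalently, the linear map φ from the space of C^∞ functions ℝ → ℝ to the space of sequences ℕ → ℝ given by φ(f)(n) = f⁽ⁿ⁾(0) is surjective. -/
/-- Borel's theorem: the jet map `f ↦ (n ↦ f⁽ⁿ⁾(0))` from smooth functions to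
sequences is surjective. -/
theorem borel_jet_surjective (a : ℕ → ℝ) :
    ∃ f : ℝ → ℝ, ContDiff ℝ (⊤ : ℕ∞) f ∧ ∀ n : ℕ, iteratedDeriv n f 0 = a n := by
  let χ : ContDiffBump (0 : ℝ) := ⟨1, 2, by norm_num, by norm_num⟩
  let g : ℕ → ℝ → ℝ := fun n x => x ^ n * χ x
  have hg : ∀ n (m : ℕ∞), ContDiff ℝ m (g n) := fun n m =>
    (contDiff_id.pow n).mul χ.contDiff
  have hgs : ∀ n, HasCompactSupport (g n) := fun n => χ.hasCompactSupport.mul_left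
  have hB : ∀ n k, ∃ B : ℝ, ∀ x, ‖iteratedFDeriv ℝ k (g n) x‖ ≤ B := fun n k =>
    ((hgs n).iteratedFDeriv k).exists_bound_of_continuous
      ((hg n k).continuous_iteratedFDeriv (by simp))
  choose B hB using hB
  have hB0 : ∀ n k, 0 ≤ B n k := fun n k => (norm_nonneg _).trans (hB n k 0)
  let C : ℕ → ℝ := fun n => ∑ k ∈ Finset.range n, B n k
  let b : ℕ → ℝ := fun n => a n / n.factorial
  let c : ℕ → ℝ := fun n => 1 + |b n| * C n * 2 ^ n
  have hC0 : ∀ n, 0 ≤ C n := fun n => Finset.sum_nonneg fun k _ => hB0 n k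
  have hc : ∀ n, 1 ≤ c n := fun n => by
    have := hC0 n
    have : 0 ≤ |b n| * C n * 2 ^ n := by positivity
    simp only [c]; linarith
  have hcp : ∀ n, 0 < c n := fun n => by linarith [hc n]
  let f : ℕ → ℝ → ℝ := fun n x => (b n / c n ^ n) * g n (c n * x)
  have hf : ∀ n, ContDiff ℝ ((⊤ : ℕ∞) : WithTop ℕ∞) (f n) := fun n =>
    contDiff_const.mul ((hg n ⊤).comp (contDiff_const.mul contDiff_id))
  have hfd : ∀ n k x, iteratedDeriv k (f n) x =
      (b n / c n ^ n) * (c n ^ k * iteratedDeriv k (g n) (c n * x)) := fun n k x => by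
    simp only [f]
    rw [iteratedDeriv_const_mul_field, iteratedDeriv_comp_const_mul (hg n k)]
  let w : ℕ → ℕ → ℝ := fun k n => |b n| / c n ^ n * (c n ^ k * B n k)
  have hfw : ∀ k n x, ‖iteratedFDeriv ℝ k (f n) x‖ ≤ w k n := fun k n x => by
    rw [norm_iteratedFDeriv_eq_norm_iteratedDeriv, hfd, norm_mul, norm_mul, norm_div, norm_pow,
      norm_pow, Real.norm_of_nonneg (hcp n).le, Real.norm_eq_abs (b n)]
    have h1 := hB n k (c n * x)
    rw [norm_iteratedFDeriv_eq_norm_iteratedDeriv] at h1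
    have := hcp n
    simp only [w]
    gcongr
  have hw0 : ∀ k n, 0 ≤ w k n := fun k n => by
    have := hcp n
    have := hB0 n k
    simp only [w]; positivity
  have hwlt : ∀ k n, k < n → w k n ≤ (1 / 2) ^ n := fun k n hkn => by
    have hp := hcp n
    have h1 : B n k ≤ C n :=
      Finset.single_le_sum (f := fun k => B n k) (fun i _ => hB0 n i) (Finset.mem_range.2 hkn)
    have h2 : c n ^ k * c n ≤ c n ^ n := by
      rw [← pow_succ]; exact pow_le_pow_right₀ (hc n) hkn
    have h3 : |b n| * B n k * 2 ^ n ≤ c n := by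
      have : |b n| * B n k * 2 ^ n ≤ |b n| * C n * 2 ^ n := by gcongr
      simp only [c]; linarith
    have h4 : w k n = (|b n| * B n k * c n ^ k) / c n ^ n := by simp only [w]; ring
    rw [h4, div_pow, one_pow, div_le_div_iff₀ (by positivity) (by positivity)]
    calc |b n| * B n k * c n ^ k * 2 ^ n = c n ^ k * (|b n| * B n k * 2 ^ n) := by ring
      _ ≤ c n ^ k * c n := by gcongr
      _ ≤ 1 * c n ^ n := by linarith
  have hws : ∀ k, Summable (w k) := fun k => by
    rw [← summable_nat_add_iff (k + 1)]
    refine Summable.of_nonneg_of_le (fun n => hw0 _ _) (fun n => hwlt k _ (by omega)) ?_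
    exact (summable_nat_add_iff (k + 1)).2
      (summable_geometric_of_lt_one (by norm_num) (by norm_num))
  have hf0 : ∀ n k, iteratedDeriv k (f n) 0 = if k = n then a n else 0 := fun n k => by
    have hev : g n =ᶠ[nhds 0] fun x => x ^ n := by
      filter_upwards [χ.eventuallyEq_one] with x hx
      simp [g, hx]
    rw [hfd, mul_zero, hev.iteratedDeriv_eq, iteratedDeriv_fun_pow_zero]
    split_ifs with h
    · subst h
      have := (hcp k).ne'
      simp only [b]
      field_simp
    · simp
  refine ⟨fun x => ∑' n, f n x, contDiff_tsum hf (fun k _ => hws k) (fun k n x _ => hfw k n x), ?_⟩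
  intro n
  rw [iteratedDeriv_eq_iteratedFDeriv, iteratedFDeriv_tsum_apply hf (fun k _ => hws k)
    (fun k n x _ => hfw k n x) (by exact le_top), tsum_eq_single n,
    ← iteratedDeriv_eq_iteratedFDeriv, hf0, if_pos rfl]
  intro m hm
  rw [← norm_eq_zero, norm_iteratedFDeriv_eq_norm_iteratedDeriv, hf0, if_neg hm.symm, norm_zero]
end

section
/- (Generalized Borel's theorem, Remark 4.4.) Let U be an open subset of ℝ^d and let (f_k)_{k ∈ ℕ} be a family of functions f_k : U → ℝ, each C^∞ on U. Then there exists a function d : ℝ^d × ℝ → ℝ which is C^∞ on U × ℝ such that for every k ∈ ℕ and every x ∈ U, the k-th derivative at 0 of the function t ↦ d(x, t) equals f_k(x). -/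
open Filter Topology

/-- A countable family of cutoff functions adapted to an open set. -/
lemma gb_cutoffs {d : ℕ} {U : Set (Fin d → ℝ)} (hU : IsOpen U) :
    ∃ φ : ℕ → (Fin d → ℝ) → ℝ, (∀ n, ContDiff ℝ (⊤ : ℕ∞) (φ n)) ∧
      (∀ n, HasCompactSupport (φ n)) ∧ (∀ n, tsupport (φ n) ⊆ U) ∧
      ∀ x ∈ U, ∃ n, ∀ᶠ y in 𝓝 x, φ n y = 1 := by
  rcases U.eq_empty_or_nonempty with hE | hne
  · refine ⟨fun _ _ => 0, fun n => contDiff_const, fun n => HasCompactSupport.zero, ?_, ?_⟩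
    · intro n
      have : tsupport (fun _ : Fin d → ℝ => (0 : ℝ)) = ∅ := tsupport_eq_empty_iff.2 rfl
      simp [this]
    · intro x hx
      simp [hE] at hx
  have h1 : ∀ x : Fin d → ℝ, ∃ g : (Fin d → ℝ) → ℝ, x ∈ U → (ContDiff ℝ (⊤ : ℕ∞) g ∧
      HasCompactSupport g ∧ tsupport g ⊆ U ∧ ∀ᶠ y in 𝓝 x, g y = 1) := by
    intro x
    by_cases hx : x ∈ U
    · obtain ⟨r, hr, hrU⟩ := Metric.nhds_basis_closedBall.mem_iff.1 (hU.mem_nhds hx)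
      let c : ContDiffBump x :=
        { rIn := r / 2
          rOut := r
          rIn_pos := half_pos hr
          rIn_lt_rOut := half_lt_self hr }
      refine ⟨c, fun _ => ⟨c.contDiff, c.hasCompactSupport, ?_, c.eventuallyEq_one⟩⟩
      rw [c.tsupport_eq]
      exact hrU
    · exact ⟨0, fun h => absurd h hx⟩
  choose g hg using h1
  obtain ⟨t, htU, htc, hcov⟩ := TopologicalSpace.countable_cover_nhdsWithin
    (f := fun x => interior {y | g x y = 1}) (s := U) (fun x hx =>
      mem_nhdsWithin_of_mem_nhds (interior_mem_nhds.2 (hg x hx).2.2.2))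
  have htne : t.Nonempty := by
    obtain ⟨x, hx⟩ := hne
    have := hcov hx
    simp only [Set.mem_iUnion] at this
    obtain ⟨i, hi, -⟩ := this
    exact ⟨i, hi⟩
  obtain ⟨s, hs⟩ := htc.exists_eq_range htne
  have hsU : ∀ n, s n ∈ U := fun n => htU (hs ▸ Set.mem_range_self n)
  refine ⟨fun n => g (s n), fun n => (hg _ (hsU n)).1, fun n => (hg _ (hsU n)).2.1,
    fun n => (hg _ (hsU n)).2.2.1, ?_⟩
  intro x hx
  have := hcov hx
  simp only [Set.mem_iUnion] at this
  obtain ⟨i, hi, hxi⟩ := this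
  rw [hs] at hi
  obtain ⟨n, rfl⟩ := hi
  exact ⟨n, mem_interior_iff_mem_nhds.1 hxi⟩

lemma gb_mul_contDiff {d : ℕ} {U : Set (Fin d → ℝ)} (hU : IsOpen U)
    {φ f : (Fin d → ℝ) → ℝ} (hφ : ContDiff ℝ (⊤ : ℕ∞) φ) (hs : tsupport φ ⊆ U)
    (hf : ContDiffOn ℝ (⊤ : ℕ∞) f U) : ContDiff ℝ (⊤ : ℕ∞) (fun x => φ x * f x) := by
  rw [contDiff_iff_contDiffAt]
  intro x
  by_cases hx : x ∈ tsupport φ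
  · exact hφ.contDiffAt.mul (hf.contDiffAt (hU.mem_nhds (hs hx)))
  · have h0 := notMem_tsupport_iff_eventuallyEq.1 hx
    have : (fun x => φ x * f x) =ᶠ[𝓝 x] fun _ => 0 := by
      filter_upwards [h0] with y hy
      simp [hy]
    exact contDiffAt_const.congr_of_eventuallyEq this

/-- Derivatives up to a given order of a compactly supported smooth function are bounded. -/
lemma gb_bound {E : Type*} [NormedAddCommGroup E] [NormedSpace ℝ E]
    {g : E → ℝ} (hg : ContDiff ℝ (⊤ : ℕ∞) g) (hc : HasCompactSupport g) (i : ℕ) :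
    ∃ C : ℝ, ∀ x, ‖iteratedFDeriv ℝ i g x‖ ≤ C :=
  (hg.continuous_iteratedFDeriv (m := i) (by exact_mod_cast le_top)).bounded_above_of_compact_support
    (hc.iteratedFDeriv i)

lemma gb_h (k : ℕ) {ε : ℝ} (hε : 0 < ε) :
    ∃ h : ℝ → ℝ, ContDiff ℝ (⊤ : ℕ∞) h ∧
      (∀ j, iteratedDeriv j h 0 = if j = k then 1 else 0) ∧
      ∀ i < k, ∀ t, ‖iteratedFDeriv ℝ i h t‖ ≤ ε := by
  let c : ContDiffBump (0 : ℝ) := ⟨1, 2, one_pos, one_lt_two⟩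
  let g : ℝ → ℝ := fun t => (k.factorial : ℝ)⁻¹ * t ^ k * c t
  have hg : ContDiff ℝ (⊤ : ℕ∞) g := (contDiff_const.mul (contDiff_id.pow k)).mul c.contDiff
  have hgc : HasCompactSupport g := c.hasCompactSupport.mul_left
  choose B hB using fun i => gb_bound hg hgc i
  let M : ℝ := ∑ i ∈ Finset.range k, |B i|
  have hM : ∀ i < k, ∀ t, ‖iteratedFDeriv ℝ i g t‖ ≤ M := fun i hi t =>
    ((hB i t).trans (le_abs_self _)).trans
      (Finset.single_le_sum (f := fun i => |B i|) (fun _ _ => abs_nonneg _) (Finset.mem_range.2 hi))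
  have hM0 : 0 ≤ M := Finset.sum_nonneg fun _ _ => abs_nonneg _
  let l : ℝ := 1 + M / ε
  have hl1 : 1 ≤ l := by have : 0 ≤ M / ε := by positivity
                         simp only [l]; linarith
  have hl0 : 0 < l := by linarith
  have hMl : M ≤ ε * l := by
    simp only [l]
    field_simp
    linarith
  refine ⟨fun t => (l ^ k)⁻¹ * g (l * t), ?_, ?_, ?_⟩
  · exact contDiff_const.mul (hg.comp (contDiff_const.mul contDiff_id))
  · intro j
    have hev : (fun t => (l ^ k)⁻¹ * g (l * t)) =ᶠ[𝓝 0]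
        fun t => (k.factorial : ℝ)⁻¹ * t ^ k := by
      have ht : Tendsto (fun t : ℝ => l * t) (𝓝 0) (𝓝 0) := by
        have : Continuous fun t : ℝ => l * t := by fun_prop
        simpa using this.tendsto 0
      filter_upwards [ht.eventually c.eventuallyEq_one] with t ht
      have ht' : c (l * t) = 1 := ht
      simp only [g, ht', mul_pow]
      field_simp
    rw [hev.iteratedDeriv_eq, iteratedDeriv_const_mul_field, iteratedDeriv_fun_pow_zero]
    split_ifs with h
    · field_simp
    · simp
  · intro i hi t
    rw [norm_iteratedFDeriv_eq_norm_iteratedDeriv, iteratedDeriv_const_mul_field,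
      iteratedDeriv_comp_const_mul (hg.of_le (by exact_mod_cast le_top))]
    have h1 := hM i hi (l * t)
    rw [norm_iteratedFDeriv_eq_norm_iteratedDeriv] at h1
    simp only [norm_mul, norm_inv, norm_pow, Real.norm_of_nonneg hl0.le]
    have h2 : l ^ i * l ≤ l ^ k := by
      rw [← pow_succ]
      exact pow_le_pow_right₀ hl1 hi
    rw [inv_mul_le_iff₀ (by positivity)]
    calc l ^ i * ‖iteratedDeriv i g (l * t)‖ ≤ l ^ i * (ε * l) := by gcongr; exact h1.trans hMl
      _ = ε * (l ^ i * l) := by ring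
      _ ≤ ε * l ^ k := by gcongr
      _ = l ^ k * ε := by ring

lemma gb_comp_bound {E F : Type*} [NormedAddCommGroup E] [NormedSpace ℝ E]
    [NormedAddCommGroup F] [NormedSpace ℝ F] (L : F →L[ℝ] E) (hL : ‖L‖ ≤ 1)
    {g : E → ℝ} (hg : ContDiff ℝ (⊤ : ℕ∞) g) (i : ℕ) (x : F) :
    ‖iteratedFDeriv ℝ i (fun y => g (L y)) x‖ ≤ ‖iteratedFDeriv ℝ i g (L x)‖ := by
  have := L.iteratedFDeriv_comp_right hg x (i := i) (by exact_mod_cast le_top)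
  change ‖iteratedFDeriv ℝ i (g ∘ L) x‖ ≤ _
  rw [this]
  refine (ContinuousMultilinearMap.norm_compContinuousLinearMap_le _ _).trans ?_
  refine mul_le_of_le_one_right (norm_nonneg _) ?_
  exact Finset.prod_le_one (fun _ _ => norm_nonneg _) (fun _ _ => hL)

lemma gb_prod_bound {E : Type*} [NormedAddCommGroup E] [NormedSpace ℝ E]
    {a : E → ℝ} {h : ℝ → ℝ} (ha : ContDiff ℝ (⊤ : ℕ∞) a) (hh : ContDiff ℝ (⊤ : ℕ∞) h)
    {C ε : ℝ} {i : ℕ} (haC : ∀ j ≤ i, ∀ x, ‖iteratedFDeriv ℝ j a x‖ ≤ C)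
    (hhe : ∀ j ≤ i, ∀ t, ‖iteratedFDeriv ℝ j h t‖ ≤ ε) (p : E × ℝ) :
    ‖iteratedFDeriv ℝ i (fun p : E × ℝ => a p.1 * h p.2) p‖ ≤ 2 ^ i * (C * ε) := by
  have hC : 0 ≤ C := (norm_nonneg _).trans (haC 0 (Nat.zero_le _) p.1)
  refine (norm_iteratedFDeriv_mul_le (ha.comp contDiff_fst) (hh.comp contDiff_snd) p
    (n := i) (by exact_mod_cast le_top)).trans ?_
  have key : ∀ j ∈ Finset.range (i + 1),
      ((i.choose j : ℕ) : ℝ) * ‖iteratedFDeriv ℝ j (a ∘ Prod.fst) p‖ *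
        ‖iteratedFDeriv ℝ (i - j) (h ∘ Prod.snd) p‖ ≤ (i.choose j : ℕ) * (C * ε) := by
    intro j hj
    have hj' : j ≤ i := Nat.lt_succ_iff.1 (Finset.mem_range.1 hj)
    have h1 : ‖iteratedFDeriv ℝ j (a ∘ Prod.fst) p‖ ≤ C :=
      (gb_comp_bound (ContinuousLinearMap.fst ℝ E ℝ) (ContinuousLinearMap.norm_fst_le ℝ E ℝ)
        ha j p).trans (haC j hj' _)
    have h2 : ‖iteratedFDeriv ℝ (i - j) (h ∘ Prod.snd) p‖ ≤ ε :=
      (gb_comp_bound (ContinuousLinearMap.snd ℝ E ℝ) (ContinuousLinearMap.norm_snd_le ℝ E ℝ)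
        hh (i - j) p).trans (hhe _ (Nat.sub_le _ _) _)
    rw [mul_assoc]
    gcongr
  refine (Finset.sum_le_sum key).trans ?_
  rw [← Finset.sum_mul, ← Nat.cast_sum, Nat.sum_range_choose]
  push_cast
  exact le_rfl

/-- Generalized Borel's theorem: given smooth functions `f k : U → ℝ` on an open
subset `U ⊆ ℝᵈ`, there is a smooth function `d : U × ℝ → ℝ` whose `k`-th
`t`-derivative at `t = 0` is `f k`. -/
theorem generalized_borel {d : ℕ} {U : Set (Fin d → ℝ)} (hU : IsOpen U)
    (f : ℕ → (Fin d → ℝ) → ℝ) (hf : ∀ k, ContDiffOn ℝ (⊤ : ℕ∞) (f k) U) :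
    ∃ D : (Fin d → ℝ) × ℝ → ℝ, ContDiffOn ℝ (⊤ : ℕ∞) D (U ×ˢ (Set.univ : Set ℝ)) ∧
      ∀ k : ℕ, ∀ x ∈ U, iteratedDeriv k (fun t : ℝ => D (x, t)) 0 = f k x := by
  obtain ⟨φ, hφ, hφc, hφU, hφ1⟩ := gb_cutoffs hU
  have ha : ∀ n k, ContDiff ℝ (⊤ : ℕ∞) (fun x => φ n x * f k x) := fun n k =>
    gb_mul_contDiff hU (hφ n) (hφU n) (hf k)
  have hac : ∀ n k, HasCompactSupport (fun x => φ n x * f k x) := fun n k => (hφc n).mul_right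
  choose B hB using fun n k i => gb_bound (ha n k) (hac n k) i
  let C : ℕ → ℝ := fun k => ∑ n ∈ Finset.range (k + 1), ∑ i ∈ Finset.range (k + 1), |B n k i|
  have hC0 : ∀ k, 0 ≤ C k := fun k =>
    Finset.sum_nonneg fun _ _ => Finset.sum_nonneg fun _ _ => abs_nonneg _
  have hC : ∀ k, ∀ n ≤ k, ∀ i ≤ k, ∀ x,
      ‖iteratedFDeriv ℝ i (fun x => φ n x * f k x) x‖ ≤ C k := by
    intro k n hn i hi x
    refine ((hB n k i x).trans (le_abs_self _)).trans ?_
    refine (Finset.single_le_sum (f := fun i => |B n k i|) (fun _ _ => abs_nonneg _)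
      (Finset.mem_range.2 (Nat.lt_succ_iff.2 hi))).trans ?_
    exact Finset.single_le_sum (f := fun n => ∑ i ∈ Finset.range (k + 1), |B n k i|)
      (fun _ _ => Finset.sum_nonneg fun _ _ => abs_nonneg _)
      (Finset.mem_range.2 (Nat.lt_succ_iff.2 hn))
  let ε : ℕ → ℝ := fun k => (1 / 2) ^ k / (2 ^ k * (C k + 1))
  have hε : ∀ k, 0 < ε k := fun k => by
    have := hC0 k
    simp only [ε]
    positivity
  have hεC : ∀ k, 2 ^ k * (C k * ε k) ≤ (1 / 2) ^ k := fun k => by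
    have := hC0 k
    have e : 2 ^ k * (C k * ε k) = (C k / (C k + 1)) * (1 / 2) ^ k := by
      simp only [ε]
      field_simp
    rw [e]
    refine mul_le_of_le_one_left (by positivity) ?_
    rw [div_le_one (by positivity)]
    linarith
  have hεC' : ∀ k, ∀ i ≤ k, 2 ^ i * (C k * ε k) ≤ (1 / 2) ^ k := fun k i hi => by
    refine le_trans ?_ (hεC k)
    have := hC0 k
    have := hε k
    gcongr
    norm_num
  choose h hh hh0 hhb using fun k => gb_h k (hε k)
  have hgeo : ∀ m : ℕ, Summable fun i : ℕ => (1 / 2 : ℝ) ^ (i + m) := fun m =>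
    (summable_nat_add_iff m).2 summable_geometric_two
  -- pointwise bound of the coefficients
  have hfC : ∀ n x, φ n x = 1 → ∀ k, n ≤ k → |f k x| ≤ C k := by
    intro n x hx k hk
    have := hC k n hk 0 (Nat.zero_le _) x
    simpa [hx] using this
  have hder : ∀ n x, φ n x = 1 → ∀ k, n ≤ k → ∀ i < k, ∀ t,
      ‖iteratedFDeriv ℝ i (fun t => f k x * h k t) t‖ ≤ (1 / 2) ^ k := by
    intro n x hx k hk i hi t
    rw [norm_iteratedFDeriv_eq_norm_iteratedDeriv, iteratedDeriv_const_mul_field, norm_mul]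
    have h1 := hhb k i hi t
    rw [norm_iteratedFDeriv_eq_norm_iteratedDeriv] at h1
    have h2 : ‖f k x‖ ≤ C k := hfC n x hx k hk
    have := hεC' k 0 (Nat.zero_le _)
    rw [pow_zero, one_mul] at this
    exact (mul_le_mul h1 h2 (norm_nonneg _) (hε k).le |>.trans_eq (mul_comm _ _)
      |> (mul_comm _ _).trans_le).trans this
  have hsum : ∀ n x, φ n x = 1 → ∀ t, Summable fun k => f k x * h k t := by
    intro n x hx t
    rw [← summable_nat_add_iff (n + 1)]
    refine Summable.of_norm_bounded (hgeo (n + 1)) fun i => ?_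
    have := hder n x hx (i + (n + 1)) (by omega) 0 (by omega) t
    simpa using this
  refine ⟨fun p => ∑' k, f k p.1 * h k p.2, ?_, ?_⟩
  · rintro ⟨x, t⟩ ⟨hx, -⟩
    apply ContDiffAt.contDiffWithinAt
    obtain ⟨n, hn⟩ := hφ1 x hx
    have hev : (fun p : (Fin d → ℝ) × ℝ => ∑' k, f k p.1 * h k p.2) =ᶠ[𝓝 (x, t)]
        fun p => ∑ k ∈ Finset.range n, f k p.1 * h k p.2 +
          ∑' k, (φ n p.1 * f (k + n) p.1) * h (k + n) p.2 := by
      filter_upwards [(continuous_fst.tendsto (x, t)).eventually hn] with p hp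
      rw [← (hsum n p.1 hp p.2).sum_add_tsum_nat_add n]
      simp [hp]
    refine ContDiffAt.congr_of_eventuallyEq ?_ hev
    refine ContDiffAt.add ?_ ?_
    · refine ContDiffAt.sum fun k _ => ?_
      refine ContDiffAt.mul ?_ ((hh k).contDiffAt.comp _ contDiffAt_snd)
      exact ((hf k).contDiffAt (hU.mem_nhds hx)).comp (x, t) contDiffAt_fst
    · refine ContDiff.contDiffAt ?_
      refine contDiff_tsum_of_eventually (v := fun _ i => (1 / 2 : ℝ) ^ (i + n))
        (fun k => ((ha n (k + n)).comp contDiff_fst).mul ((hh (k + n)).comp contDiff_snd))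
        (fun _ _ => hgeo n) ?_
      intro i _
      rw [Nat.cofinite_eq_atTop]
      filter_upwards [eventually_gt_atTop i] with k hk p
      refine (gb_prod_bound (ha n (k + n)) (hh (k + n)) (C := C (k + n)) (ε := ε (k + n))
        (fun j hj => hC (k + n) n (by omega) j (by omega))
        (fun j hj => hhb (k + n) j (by omega)) p).trans (hεC' _ _ (by omega))
  · intro k x hx
    obtain ⟨n, hn⟩ := hφ1 x hx
    have hx1 : φ n x = 1 := hn.self_of_nhds
    let m := n + k + 1
    have hsplit : (fun t : ℝ => ∑' j, f j x * h j t) =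
        (fun t => ∑ j ∈ Finset.range m, f j x * h j t) +
          fun t => ∑' j, f (j + m) x * h (j + m) t := by
      funext t
      exact ((hsum n x hx1 t).sum_add_tsum_nat_add m).symm
    have hsm : ∀ j, ∀ N : ℕ, ContDiff ℝ N (fun t => f j x * h j t) := fun j N =>
      (contDiff_const.mul (hh j)).of_le (by exact_mod_cast le_top)
    have hb : ∀ (i j : ℕ) (t : ℝ), (i : ℕ∞) ≤ (k : ℕ∞) →
        ‖iteratedFDeriv ℝ i (fun t => f (j + m) x * h (j + m) t) t‖ ≤ (1 / 2) ^ (j + m) := by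
      intro i j t hi
      have hi' : i ≤ k := by exact_mod_cast hi
      exact hder n x hx1 (j + m) (by omega) i (by omega) t
    have htail : ContDiff ℝ (k : ℕ∞) (fun t => ∑' j, f (j + m) x * h (j + m) t) :=
      contDiff_tsum (v := fun _ j => (1 / 2 : ℝ) ^ (j + m)) (fun j => hsm _ _)
        (fun _ _ => hgeo m) hb
    have hterm : ∀ j, iteratedDeriv k (fun t => f j x * h j t) 0 = if k = j then f j x else 0 := by
      intro j
      rw [iteratedDeriv_const_mul_field, hh0]
      simp
    have htail0 : iteratedDeriv k (fun t => ∑' j, f (j + m) x * h (j + m) t) 0 = 0 := by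
      rw [iteratedDeriv_eq_iteratedFDeriv, iteratedFDeriv_tsum
        (v := fun _ j => (1 / 2 : ℝ) ^ (j + m)) (N := k) (fun j => hsm _ _)
        (fun _ _ => hgeo m) hb le_rfl]
      have : ∀ j, iteratedFDeriv ℝ k (fun t => f (j + m) x * h (j + m) t) 0 = 0 := by
        intro j
        rw [← norm_eq_zero, norm_iteratedFDeriv_eq_norm_iteratedDeriv, hterm, if_neg (by omega),
          norm_zero]
      simp [this]
    change iteratedDeriv k (fun t : ℝ => ∑' j, f j x * h j t) 0 = f k x
    rw [hsplit, iteratedDeriv_add (ContDiff.sum fun j _ => hsm j k).contDiffAt htail.contDiffAt,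
      htail0, add_zero, iteratedDeriv_fun_sum (fun j _ => (hsm j k).contDiffAt)]
    simp only [hterm]
    rw [Finset.sum_ite_eq, if_pos (Finset.mem_range.2 (by omega))]
end

section
/- (Claim 2 of Example 4.3: the D-topology on the countable product ∏_ω ℝ is the product topology; restated via smooth curves.) A subset A of the space ℕ → ℝ of real sequences is open in the product topology if and only if for every curve c : ℝ → (ℕ → ℝ) such that for each n ∈ ℕ the coordinate function t ↦ c(t)(n) is C^∞, the preimage c⁻¹(A) is open in ℝ. -/
/-- Smooth compactly supported bumps separating the points `2^{-k}`. -/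
lemma exists_bumps : ∃ φ : ℕ → ℝ → ℝ, (∀ k, ContDiff ℝ (⊤ : ℕ∞) (φ k)) ∧
    (∀ k, HasCompactSupport (φ k)) ∧ (∀ k, φ k 0 = 0) ∧
    (∀ k, φ k ((1 / 2 : ℝ) ^ k) = 1) ∧
    (∀ k j, j ≠ k → φ k ((1 / 2 : ℝ) ^ j) = 0) := by
  have hpos : ∀ k : ℕ, (0 : ℝ) < (1 / 2 : ℝ) ^ k := fun k => by positivity
  let B : ∀ k : ℕ, ContDiffBump ((1 / 2 : ℝ) ^ k) := fun k =>
    { rIn := (1 / 2 : ℝ) ^ k / 4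
      rOut := (1 / 2 : ℝ) ^ k / 2
      rIn_pos := by positivity
      rIn_lt_rOut := by linarith [hpos k] }
  refine ⟨fun k => B k, fun k => (B k).contDiff, fun k => (B k).hasCompactSupport, ?_, ?_, ?_⟩
  · intro k
    apply (B k).zero_of_le_dist
    change (1 / 2 : ℝ) ^ k / 2 ≤ _
    rw [Real.dist_eq, zero_sub, abs_neg, abs_of_pos (hpos k)]
    linarith [hpos k]
  · intro k
    apply (B k).one_of_mem_closedBall
    exact Metric.mem_closedBall_self (B k).rIn_pos.le
  · intro k j hjk
    apply (B k).zero_of_le_dist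
    change (1 / 2 : ℝ) ^ k / 2 ≤ _
    rw [Real.dist_eq]
    rcases lt_or_gt_of_ne hjk with h | h
    · have h1 : (1 / 2 : ℝ) ^ k ≤ (1 / 2 : ℝ) ^ (j + 1) :=
        pow_le_pow_of_le_one (by norm_num) (by norm_num) h
      rw [pow_succ] at h1
      refine le_trans ?_ (le_abs_self _)
      linarith [hpos k]
    · have h1 : (1 / 2 : ℝ) ^ j ≤ (1 / 2 : ℝ) ^ (k + 1) :=
        pow_le_pow_of_le_one (by norm_num) (by norm_num) h
      rw [pow_succ] at h1
      refine le_trans ?_ (neg_le_abs _)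
      linarith [hpos k]

lemma exists_bound (f : ℝ → ℝ) (hf : ContDiff ℝ (⊤ : ℕ∞) f) (hc : HasCompactSupport f)
    (m : ℕ) : ∃ M : ℝ, 0 < M ∧ ∀ k ≤ m, ∀ x, ‖iteratedFDeriv ℝ k f x‖ ≤ M := by
  have h : ∀ k : ℕ, ∃ C : ℝ, ∀ x, ‖iteratedFDeriv ℝ k f x‖ ≤ C := fun k =>
    (hc.iteratedFDeriv k).exists_bound_of_continuous
      (hf.continuous_iteratedFDeriv (by exact_mod_cast le_top))
  choose C hC using h
  have hC0 : ∀ k, 0 ≤ C k := fun k => (norm_nonneg _).trans (hC k 0)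
  refine ⟨∑ k ∈ Finset.range (m + 1), C k + 1, ?_, ?_⟩
  · have := Finset.sum_nonneg (s := Finset.range (m + 1)) fun k _ => hC0 k
    linarith
  · intro k hk x
    have := Finset.single_le_sum (s := Finset.range (m + 1)) (f := C) (fun k _ => hC0 k)
      (Finset.mem_range.2 (Nat.lt_succ_of_le hk))
    linarith [hC k x]

/-- The D-topology on `∏_ω ℝ` is the product topology: a set `A ⊆ (ℕ → ℝ)` is
open in the product topology iff its preimage under every smooth curve
`c : ℝ → (ℕ → ℝ)` (i.e. every coordinate `t ↦ c t n` is `C^∞`) is open in `ℝ`. -/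
theorem dTopology_pi_eq_product (A : Set (ℕ → ℝ)) :
    IsOpen A ↔
      ∀ c : ℝ → ℕ → ℝ, (∀ n : ℕ, ContDiff ℝ (⊤ : ℕ∞) (fun t : ℝ => c t n)) →
        IsOpen (c ⁻¹' A) := by
  constructor
  · intro hA c hc
    exact hA.preimage (continuous_pi fun n => (hc n).continuous)
  intro H
  rw [isOpen_iff_mem_nhds]
  intro x hx
  by_contra hnot
  obtain ⟨φ, hφ, hφc, hφ0, hφ1, hφne⟩ := exists_bumps
  choose M hM0 hM using fun k => exists_bound (φ k) (hφ k) (hφc k) k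
  have hex : ∀ k : ℕ, ∃ y : ℕ → ℝ, (∀ n ≤ k, |y n - x n| < (1 / 2 : ℝ) ^ k / M k) ∧ y ∉ A := by
    intro k
    by_contra hcon
    push Not at hcon
    apply hnot
    have hev : ∀ᶠ y in nhds x, ∀ n ∈ Set.Iic k, |y n - x n| < (1 / 2 : ℝ) ^ k / M k := by
      rw [Filter.eventually_all_finite (Set.finite_Iic k)]
      intro n _
      have hc : ContinuousAt (fun y : ℕ → ℝ => y n) x := (continuous_apply n).continuousAt
      exact hc.eventually (Metric.ball_mem_nhds (x n) (div_pos (by positivity) (hM0 k)))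
    filter_upwards [hev] with y hy
    exact hcon y hy
  choose y hy hyA using hex
  let c : ℝ → ℕ → ℝ := fun t n => x n + ∑' k, (y k n - x n) * φ k t
  have hc : ∀ n : ℕ, ContDiff ℝ (⊤ : ℕ∞) (fun t : ℝ => c t n) := by
    intro n
    refine contDiff_const.add ?_
    refine contDiff_tsum_of_eventually (v := fun _ i => (1 / 2 : ℝ) ^ i)
      (fun i => contDiff_const.mul (hφ i)) (fun _ _ => summable_geometric_two) ?_
    intro k _
    rw [Nat.cofinite_eq_atTop]
    filter_upwards [Filter.eventually_ge_atTop k, Filter.eventually_ge_atTop n] with i hik hin t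
    have e : iteratedFDeriv ℝ k (fun t => (y i n - x n) * φ i t) t
        = (y i n - x n) • iteratedFDeriv ℝ k (φ i) t :=
      iteratedFDeriv_const_smul_apply (a := y i n - x n) (i := k) (x := t) (f := φ i)
        (((hφ i).of_le (by exact_mod_cast le_top)).contDiffAt)
    rw [e, norm_smul, Real.norm_eq_abs]
    calc _ ≤ (1 / 2 : ℝ) ^ i / M i * M i :=
          mul_le_mul (hy i n hin).le (hM i k hik t) (norm_nonneg _)
            (div_pos (by positivity) (hM0 i)).le
      _ = _ := div_mul_cancel₀ _ (hM0 i).ne'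
  have hc0 : c 0 = x := by
    funext n
    simp [c, hφ0]
  have hck : ∀ k, c ((1 / 2 : ℝ) ^ k) = y k := by
    intro k
    funext n
    simp only [c]
    rw [tsum_eq_single k, hφ1]
    · ring
    · intro j hj
      rw [hφne j k hj.symm, mul_zero]
  have hmem : c ⁻¹' A ∈ nhds (0 : ℝ) := (H c hc).mem_nhds (by simpa [hc0] using hx)
  have ht : Filter.Tendsto (fun k : ℕ => (1 / 2 : ℝ) ^ k) Filter.atTop (nhds 0) :=
    tendsto_pow_atTop_nhds_zero_of_lt_one (by norm_num) (by norm_num)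
  obtain ⟨k, hk⟩ := (ht.eventually hmem).exists
  apply hyA k
  rw [← hck k]
  exact hk
end
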